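/- Let T = (T_1,…,T_n) be a bilateral weighted shift on K_ω with bounded weights Λ = {λ_u}_{u∈F_ω} satisfying λ_u > 0 for all u, let S = (S_1,…,S_n) be the unweighted shift on K_ω, and for 1 ≤ i ≤ n let W_i be the bounded positive diagonal operator with W_i ξ_u = λ_{iu} ξ_u. Then a closed subspace H of K_ω is a joint reducing subspace for the family {T_1,…,T_n} if and only if it is a joint reducing subspace for the family {S_1,…,S_n, W_1,…,W_n}. -/

import Mathlib

open scoped ENNReal InnerProductSpace

noncomputable section

variable {n : ℕ}

/-- The element of the free group determined by a word (list of generators). -/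
def wordProd (l : List (Fin n)) : FreeGroup (Fin n) := (l.map FreeGroup.of).prod

/-- The initial segment `ω_m = i_1 i_2 ⋯ i_m` of an infinite word `ω`. -/
def initSeg (ω : ℕ → Fin n) (m : ℕ) : List (Fin n) := List.ofFn fun j : Fin m => ω j

/-- The set `F_ω = { v ω_m⁻¹ : v ∈ F_n^+, m ≥ 0 }` inside the free group. -/
def Fomega (ω : ℕ → Fin n) : Set (FreeGroup (Fin n)) :=
  {g | ∃ (v : List (Fin n)) (m : ℕ), g = wordProd v * (wordProd (initSeg ω m))⁻¹}

lemma genMul_mem (ω : ℕ → Fin n) (i : Fin n) {g : FreeGroup (Fin n)} (hg : g ∈ Fomega ω) :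
    FreeGroup.of i * g ∈ Fomega ω := by
  obtain ⟨v, m, rfl⟩ := hg
  exact ⟨i :: v, m, by simp [wordProd, mul_assoc]⟩

/-- `K_ω = ℓ²(F_ω)`. -/
abbrev Komega (ω : ℕ → Fin n) : Type _ := lp (fun _ : Fomega ω => ℂ) 2

/-- The standard orthonormal basis vector `ξ_u` of `K_ω`. -/
def xi (ω : ℕ → Fin n) (u : Fomega ω) : Komega ω := lp.single 2 u 1

/-- `iu` as an element of `F_ω`. -/
def gen (ω : ℕ → Fin n) (i : Fin n) (u : Fomega ω) : Fomega ω :=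
  ⟨FreeGroup.of i * u.1, genMul_mem ω i u.2⟩

/-- `T = (T_1,…,T_n)` is the bilateral weighted shift on `K_ω` with (complex) weights `Λ`:
`T_i ξ_u = λ_{iu} ξ_{iu}`. -/
def IsWeightedShift (ω : ℕ → Fin n) (Λ : Fomega ω → ℂ)
    (T : Fin n → Komega ω →L[ℂ] Komega ω) : Prop :=
  ∀ (i : Fin n) (u : Fomega ω), T i (xi ω u) = Λ (gen ω i u) • xi ω (gen ω i u)

/-- real-weight version -/
def IsWeightedShiftR (ω : ℕ → Fin n) (Λ : Fomega ω → ℝ)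
    (T : Fin n → Komega ω →L[ℂ] Komega ω) : Prop :=
  ∀ (i : Fin n) (u : Fomega ω), T i (xi ω u) = (Λ (gen ω i u) : ℂ) • xi ω (gen ω i u)

/-- A closed subspace `H` is reducing for an operator `A` if `H` and `Hᗮ` are `A`-invariant. -/
def Reduces {E : Type*} [NormedAddCommGroup E] [InnerProductSpace ℂ E]
    (A : E →L[ℂ] E) (H : Submodule ℂ E) : Prop :=
  (∀ x ∈ H, A x ∈ H) ∧ ∀ x ∈ Hᗮ, A x ∈ Hᗮ

/-- `w^k` for a finite word `w`. -/
def listPow (w : List (Fin n)) : ℕ → List (Fin n)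
  | 0 => []
  | k + 1 => w ++ listPow w k

/-- A word is primitive if it is non-empty and not a proper power. -/
def Primitive (v : List (Fin n)) : Prop :=
  v ≠ [] ∧ ∀ (w : List (Fin n)) (j : ℕ), 2 ≤ j → v ≠ listPow w j

/-- `ω = v v v ⋯`. -/
def IsPeriodicWord (ω : ℕ → Fin n) (v : List (Fin n)) : Prop :=
  v ≠ [] ∧ ∀ k : ℕ, initSeg ω (k * v.length) = listPow v k

/-- `ω = u v₀ v₀ v₀ ⋯` for some words `u, v₀` with `v₀` non-empty. -/
def EventuallyPeriodic (ω : ℕ → Fin n) : Prop :=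
  ∃ N p : ℕ, 1 ≤ p ∧ ∀ m ≥ N, ω (m + p) = ω m

def Aperiodic (ω : ℕ → Fin n) : Prop := ¬EventuallyPeriodic ω

lemma reduces_iff_commute_starProjection {E : Type*} [NormedAddCommGroup E]
    [InnerProductSpace ℂ E] (A : E →L[ℂ] E) (H : Submodule ℂ E) [H.HasOrthogonalProjection] :
    Reduces A H ↔ Commute H.starProjection A := by
  constructor
  · rintro ⟨h₁, h₂⟩
    ext x
    have hx := H.starProjection_add_starProjection_orthogonal x
    have hP := h₁ _ (H.starProjection_apply_mem x)
    have hQ := h₂ _ (Hᗮ.starProjection_apply_mem x)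
    change H.starProjection (A x) = A (H.starProjection x)
    conv_lhs => rw [← hx, map_add, map_add]
    rw [Submodule.starProjection_eq_self_iff.2 hP,
      (H.starProjection_apply_eq_zero_iff).2 hQ, add_zero]
  · intro h
    have hc (x : E) : H.starProjection (A x) = A (H.starProjection x) :=
      DFunLike.congr_fun h.eq x
    refine ⟨fun x hx => ?_, fun x hx => ?_⟩
    · rw [← Submodule.starProjection_eq_self_iff, hc, Submodule.starProjection_eq_self_iff.2 hx]
    · rw [← H.starProjection_apply_eq_zero_iff, hc,
        (H.starProjection_apply_eq_zero_iff).2 hx, map_zero]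

section Komega

variable {ω : ℕ → Fin n}

lemma inner_xi_left (u : Fomega ω) (x : Komega ω) : ⟪xi ω u, x⟫_ℂ = x u := by
  simp [xi, lp.inner_single_left]

lemma inner_xi_xi (u v : Fomega ω) : ⟪xi ω u, xi ω v⟫_ℂ = if u = v then 1 else 0 := by
  rw [inner_xi_left, xi, lp.single_apply, Pi.single_apply]

lemma gen_injective (i : Fin n) : Function.Injective (gen ω i) := fun _ _ h =>
  Subtype.ext (mul_left_cancel (congrArg Subtype.val h))

lemma continuousLinearMap_ext_xi {A B : Komega ω →L[ℂ] Komega ω}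
    (h : ∀ u, A (xi ω u) = B (xi ω u)) : A = B := by
  refine lp.ext_continuousLinearMap (by simp) fun u => ?_
  ext1
  exact h u

lemma ext_inner_xi {x y : Komega ω} (h : ∀ u, ⟪xi ω u, x⟫_ℂ = ⟪xi ω u, y⟫_ℂ) : x = y := by
  ext u
  simpa only [inner_xi_left] using h u

/-- A bounded operator commuting with the square of a diagonal operator with nonnegative
entries commutes with the operator itself. -/
lemma commute_of_commute_mul_self_of_diagonal {A D : Komega ω →L[ℂ] Komega ω}
    (hD : IsSelfAdjoint D) {d : Fomega ω → ℝ} (hd : ∀ u, 0 ≤ d u)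
    (hDd : ∀ u, D (xi ω u) = (d u : ℂ) • xi ω u) (h : Commute A (D * D)) : Commute A D := by
  have hD' (u : Fomega ω) (x : Komega ω) : ⟪xi ω u, D x⟫_ℂ = d u * ⟪xi ω u, x⟫_ℂ := by
    rw [← hD.isSymmetric.apply_clm, hDd, inner_smul_left, Complex.conj_ofReal]
  refine continuousLinearMap_ext_xi fun v => ext_inner_xi fun u => ?_
  have key := congrArg (fun x => ⟪xi ω u, x⟫_ℂ) (DFunLike.congr_fun h.eq (xi ω v))
  simp only [mul_apply_eq_comp, hDd, map_smul, inner_smul_right, hD'] at key ⊢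
  by_cases hz : ⟪xi ω u, A (xi ω v)⟫_ℂ = 0
  · simp [hz]
  · simp only [← mul_assoc] at key
    have hsq : d v * d v = d u * d u := by
      exact_mod_cast mul_right_cancel₀ hz key
    rw [(mul_self_inj (hd v) (hd u)).1 hsq]

lemma adjoint_mul_self_eq_diagonal_mul_self {Λ : Fomega ω → ℝ}
    {T : Fin n → Komega ω →L[ℂ] Komega ω} (hT : IsWeightedShiftR ω Λ T) {i : Fin n}
    {D : Komega ω →L[ℂ] Komega ω}
    (hD : ∀ u, D (xi ω u) = (Λ (gen ω i u) : ℂ) • xi ω u) :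
    star (T i) * T i = D * D := by
  refine continuousLinearMap_ext_xi fun v => ext_inner_xi fun u => ?_
  rw [mul_apply_eq_comp, ContinuousLinearMap.star_eq_adjoint,
    ContinuousLinearMap.adjoint_inner_right, mul_apply_eq_comp, hT, hT, hD, map_smul,
    hD]
  simp only [inner_smul_left, inner_smul_right, inner_xi_xi, (gen_injective i).eq_iff,
    Complex.conj_ofReal]
  split_ifs with huv
  · simp [huv]
  · simp

end Komega

/-- a closed subspace jointly reduces `{T_1,…,T_n}` iff it jointly reduces
`{S_1,…,S_n, W_1,…,W_n}`. -/
theorem reduces_weighted_shift_iff_reduces_unweighted_and_diagonal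
    {n : ℕ} (hn : 2 ≤ n) (ω : ℕ → Fin n)
    (Λ : Fomega ω → ℝ) (hbdd : ∃ C : ℝ, ∀ u, ‖Λ u‖ ≤ C) (hpos : ∀ u, 0 < Λ u)
    (T : Fin n → Komega ω →L[ℂ] Komega ω) (hT : IsWeightedShiftR ω Λ T)
    (S : Fin n → Komega ω →L[ℂ] Komega ω) (hS : IsWeightedShiftR ω (fun _ => 1) S)
    (W : Fin n → Komega ω →L[ℂ] Komega ω)
    (hWpos : ∀ i, (W i).IsPositive)
    (hW : ∀ (i : Fin n) (u : Fomega ω), W i (xi ω u) = (Λ (gen ω i u) : ℂ) • xi ω u)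
    (H : Submodule ℂ (Komega ω)) (hH : IsClosed (H : Set (Komega ω))) :
    (∀ i : Fin n, Reduces (T i) H) ↔
      ((∀ i : Fin n, Reduces (S i) H) ∧ ∀ i : Fin n, Reduces (W i) H) := by
  have : CompleteSpace H := hH.completeSpace_coe
  have hTSW (i : Fin n) : T i = S i * W i := by
    refine continuousLinearMap_ext_xi fun u => ?_
    rw [mul_apply_eq_comp, hW, map_smul, hS, hT,
      Complex.ofReal_one, one_smul]
  simp only [reduces_iff_commute_starProjection]
  refine ⟨fun h => ?_, fun ⟨h₁, h₂⟩ i => hTSW i ▸ (h₁ i).mul_right (h₂ i)⟩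
  have hcW (i : Fin n) : Commute H.starProjection (W i) := by
    refine commute_of_commute_mul_self_of_diagonal (hWpos i).isSelfAdjoint
      (fun u => (hpos (gen ω i u)).le) (hW i) ?_
    rw [← adjoint_mul_self_eq_diagonal_mul_self hT (hW i)]
    refine Commute.mul_right ?_ (h i)
    simpa [(isSelfAdjoint_starProjection H).star_eq] using (h i).star_star
  refine ⟨fun i => continuousLinearMap_ext_xi fun u => ?_, hcW⟩
  have hPSW : H.starProjection * S i * W i = S i * H.starProjection * W i := by
    rw [mul_assoc, ← hTSW, (h i).eq, hTSW, mul_assoc, mul_assoc, (hcW i).eq]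
  have key := DFunLike.congr_fun hPSW (xi ω u)
  rw [mul_apply_eq_comp, mul_apply_eq_comp (S i * _), hW, map_smul,
    map_smul] at key
  exact smul_right_injective _ (Complex.ofReal_ne_zero.2 (hpos _).ne') key
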